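/- For every integer n ≥ 1, N_{s,t}(1,2; 4,4; n−1) = Σ_{d∣n} χ₈(n/d)·d; that is, the number of quadruples (y₁, y₂, z₁, z₂) with y₁, y₂ integers and z₁, z₂ nonnegative integers such that n − 1 = y₁² + 2·y₂² + 4·z₁(z₁+1)/2 + 4·z₂(z₂+1)/2 equals Σ_{d∣n} χ₈(n/d)·d. -/

import Mathlib

/-- `deltaRep k c n` is the number of `k`-tuples `(x₁, …, x_k)` of nonnegative integers
with `n = Σᵢ cᵢ · xᵢ(xᵢ+1)/2`. -/
noncomputable def deltaRep (k : ℕ) (c : Fin k → ℕ) (n : ℕ) : ℕ :=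
  Set.ncard {x : Fin k → ℕ | n = ∑ i, c i * (x i * (x i + 1) / 2)}

/-- `rRep v b n` is the number of `v`-tuples `(y₁, …, y_v)` of integers with
`n = Σᵢ bᵢ · yᵢ²`. -/
noncomputable def rRep (v : ℕ) (b : Fin v → ℕ) (n : ℕ) : ℕ :=
  Set.ncard {y : Fin v → ℤ | (n : ℤ) = ∑ i, (b i : ℤ) * y i ^ 2}

/-- `qRep k c n` is the number of `k`-tuples `(y₁, …, y_k)` of positive odd integers with
`n = Σᵢ cᵢ · yᵢ²`. -/
noncomputable def qRep (k : ℕ) (c : Fin k → ℕ) (n : ℕ) : ℕ :=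
  Set.ncard {y : Fin k → ℕ | (∀ i, 0 < y i ∧ Odd (y i)) ∧ n = ∑ i, c i * y i ^ 2}

/-- `NstRep v k b c n` is the number of pairs of tuples `((y₁, …, y_v), (z₁, …, z_k))`
with the `yᵢ` integers and the `z_j` nonnegative integers such that
`n = Σᵢ bᵢ·yᵢ² + Σⱼ cⱼ·zⱼ(zⱼ+1)/2`. -/
noncomputable def NstRep (v k : ℕ) (b : Fin v → ℕ) (c : Fin k → ℕ) (n : ℕ) : ℕ :=
  Set.ncard {p : (Fin v → ℤ) × (Fin k → ℕ) |
    (n : ℤ) = ∑ i, (b i : ℤ) * p.1 i ^ 2 +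
      ∑ j, (c j : ℤ) * ((p.2 j * (p.2 j + 1) / 2 : ℕ) : ℤ)}

/-- The finite set of pairs `(a, b)` of nonnegative integers with `a + 2b = n`. -/
def convPairs (n : ℕ) : Finset (ℕ × ℕ) :=
  (Finset.range (n + 1) ×ˢ Finset.range (n + 1)).filter fun p => p.1 + 2 * p.2 = n

/-- The quadratic character mod 8: `χ₈(m) = 1` if `m ≡ ±1 (mod 8)`, `-1` if
`m ≡ ±3 (mod 8)`, `0` if `m` is even. -/
def chi8 (m : ℤ) : ℤ :=
  if m % 8 = 1 ∨ m % 8 = 7 then 1 else if m % 8 = 3 ∨ m % 8 = 5 then -1 else 0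

open Finset

/-- The integer solutions `(x, y)` of `x² + D·y² = n`, searched for in a box that contains them
all when `D` is positive. -/
noncomputable def normReps (D n : ℤ) : Finset (ℤ × ℤ) :=
  (Icc (-n) n ×ˢ Icc (-n) n).filter fun p => p.1 ^ 2 + D * p.2 ^ 2 = n

lemma mem_normReps {D n : ℤ} (hD : 1 ≤ D) {p : ℤ × ℤ} :
    p ∈ normReps D n ↔ p.1 ^ 2 + D * p.2 ^ 2 = n := by
  simp only [normReps, mem_filter, mem_product, mem_Icc, and_iff_right_iff_imp]
  intro h
  have h1 : p.1 ^ 2 ≤ n := by nlinarith [sq_nonneg p.2]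
  have h2 : p.2 ^ 2 ≤ n := by nlinarith [sq_nonneg p.2, sq_nonneg p.1]
  have aux : ∀ a : ℤ, a ^ 2 ≤ n → -n ≤ a ∧ a ≤ n := by
    intro a ha
    have h3 : |a| ≤ a ^ 2 := by
      rw [← sq_abs]
      rcases eq_or_ne a 0 with rfl | h0
      · simp
      · nlinarith [Int.one_le_abs h0]
    exact abs_le.mp (h3.trans ha)
  exact ⟨aux _ h1, aux _ h2⟩

/-- Scaling by `p` identifies the representations of `m` with the representations of `p² m`
by multiples of `p`. -/
lemma card_normReps_multiples {D : ℤ} (hD : 1 ≤ D) {p : ℤ} (hp : p ≠ 0) (m : ℤ) :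
    #{v ∈ normReps D (p * (p * m)) | p ∣ v.1 ∧ p ∣ v.2} = #(normReps D m) := by
  symm
  refine card_bij (fun v _ => (p * v.1, p * v.2)) ?_ ?_ ?_
  · rintro ⟨x, y⟩ h
    rw [mem_normReps hD] at h
    simp only [mem_filter, mem_normReps hD, dvd_mul_right, and_self, and_true] at h ⊢
    rw [← h]; ring
  · rintro ⟨x, y⟩ _ ⟨x', y'⟩ _ h
    simpa [hp] using h
  · rintro ⟨x, y⟩ h
    simp only [mem_filter, mem_normReps hD] at h
    obtain ⟨h, ⟨s, rfl⟩, ⟨t, rfl⟩⟩ := h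
    refine ⟨(s, t), ?_, rfl⟩
    rw [mem_normReps hD]
    have : p * p * (s ^ 2 + D * t ^ 2) = p * p * m := by linarith
    exact mul_left_cancel₀ (mul_ne_zero hp hp) this

lemma normReps_multiples_eq_empty {D : ℤ} (hD : 1 ≤ D) {p : ℤ} (hp : p ≠ 0) {m : ℤ}
    (hm : ¬ p ∣ m) : {v ∈ normReps D (p * m) | p ∣ v.1 ∧ p ∣ v.2} = ∅ := by
  rw [filter_eq_empty_iff]
  rintro ⟨x, y⟩ h ⟨⟨s, hs⟩, ⟨t, ht⟩⟩
  rw [mem_normReps hD] at h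
  simp only at hs ht h
  subst hs ht
  exact hm ⟨s ^ 2 + D * t ^ 2, mul_left_cancel₀ hp (by linarith)⟩

/-- The number of representations of `n` by `x² + D·y²`. -/
noncomputable def normCount (D : ℤ) (n : ℕ) : ℤ := #(normReps D n)

lemma normCount_multiples {D : ℤ} (hD : 1 ≤ D) {p : ℕ} (hp : p ≠ 0) (m : ℕ) :
    (#{v ∈ normReps D ((p * m : ℕ) : ℤ) | (p : ℤ) ∣ v.1 ∧ (p : ℤ) ∣ v.2} : ℤ) =
      if p ∣ m then normCount D (m / p) else 0 := by
  have hp' : (p : ℤ) ≠ 0 := by exact_mod_cast hp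
  split_ifs with h
  · obtain ⟨k, rfl⟩ := h
    rw [Nat.mul_div_cancel_left _ (Nat.pos_of_ne_zero hp), normCount,
      ← card_normReps_multiples hD hp' k]
    push_cast; rfl
  · push_cast
    rw [normReps_multiples_eq_empty hD hp' (by exact_mod_cast h)]
    simp

lemma normCount_mul_of_inert {D : ℤ} (hD : 1 ≤ D) {p : ℕ} (hp : p.Prime)
    (h : ∀ x y : ℤ, (p : ℤ) ∣ x ^ 2 + D * y ^ 2 → (p : ℤ) ∣ x ∧ (p : ℤ) ∣ y) (m : ℕ) :
    normCount D (p * m) = if p ∣ m then normCount D (m / p) else 0 := by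
  rw [← normCount_multiples hD hp.ne_zero, normCount, filter_true_of_mem]
  rintro ⟨x, y⟩ hv
  rw [mem_normReps hD] at hv
  exact h x y (hv ▸ by push_cast; exact dvd_mul_right _ _)

lemma normCount_mul_of_split {D : ℤ} (hD : 1 ≤ D) {p : ℕ} (hp : p.Prime) (h2 : p ≠ 2)
    (hpD : ¬ (p : ℤ) ∣ D) {a b : ℤ} (hab : (p : ℤ) = a ^ 2 + D * b ^ 2) (m : ℕ) :
    normCount D (p * m) =
      2 * normCount D m - if p ∣ m then normCount D (m / p) else 0 := by
  have hpp : Prime (p : ℤ) := Nat.prime_iff_prime_int.mp hp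
  have hp0 : (p : ℤ) ≠ 0 := hpp.ne_zero
  have hp1 : (1 : ℤ) < p := by exact_mod_cast hp.one_lt
  have hsq : ¬ ((p : ℤ) ∣ a ∧ (p : ℤ) ∣ b) := by
    rintro ⟨⟨s, rfl⟩, ⟨t, rfl⟩⟩
    have : (p : ℤ) * 1 = p * (p * (s ^ 2 + D * t ^ 2)) := by linarith
    have := mul_left_cancel₀ hp0 this
    exact hpp.not_isUnit (isUnit_of_dvd_one ⟨_, this⟩)
  have hb : ¬ (p : ℤ) ∣ b := by
    intro hb
    refine hsq ⟨hpp.dvd_of_dvd_pow (n := 2) ?_, hb⟩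
    have : a ^ 2 = p - D * b ^ 2 := by linarith
    rw [this]
    exact dvd_sub dvd_rfl (Dvd.dvd.mul_left (dvd_pow hb two_ne_zero) _)
  have ha : ¬ (p : ℤ) ∣ a := by
    intro ha
    refine hsq ⟨ha, hpp.dvd_of_dvd_pow (n := 2) ?_⟩
    refine (hpp.dvd_or_dvd (a := D) ?_).resolve_left hpD
    have : D * b ^ 2 = p - a ^ 2 := by linarith
    rw [this]
    exact dvd_sub dvd_rfl (dvd_pow ha two_ne_zero)
  have h2' : ¬ (p : ℤ) ∣ 2 := by
    intro h
    exact h2 ((Nat.prime_dvd_prime_iff_eq hp Nat.prime_two).mp (by exact_mod_cast h))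
  set R := normReps D ((p * m : ℕ) : ℤ) with hR
  have memR : ∀ v, v ∈ R ↔ v.1 ^ 2 + D * v.2 ^ 2 = p * m := by
    intro v; rw [hR, mem_normReps hD]; push_cast; rfl
  set A := R.filter fun v => (p : ℤ) ∣ a * v.2 - b * v.1 with hA
  set B := R.filter fun v => (p : ℤ) ∣ a * v.2 + b * v.1 with hB
  have hAB : #A = #B := by
    refine card_nbij' (fun v => (v.1, -v.2)) (fun v => (v.1, -v.2)) ?_ ?_ ?_ ?_
    · rintro ⟨x, y⟩ h
      simp only [hA, hB, coe_filter, Set.mem_ofPred_eq, memR] at h ⊢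
      refine ⟨by rw [← h.1]; ring, ?_⟩
      simpa [← sub_eq_add_neg, neg_add_eq_sub] using (dvd_neg (α := ℤ)).mpr h.2
    · rintro ⟨x, y⟩ h
      simp only [hA, hB, coe_filter, Set.mem_ofPred_eq, memR] at h ⊢
      refine ⟨by rw [← h.1]; ring, ?_⟩
      simpa [sub_eq_add_neg, add_comm] using (dvd_neg (α := ℤ)).mpr h.2
    · rintro ⟨x, y⟩ _; simp
    · rintro ⟨x, y⟩ _; simp
  have hAm : #A = #(normReps D m) := by
    symm
    refine card_bij (fun v _ => (a * v.1 - D * b * v.2, a * v.2 + b * v.1)) ?_ ?_ ?_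
    · rintro ⟨s, t⟩ h
      rw [mem_normReps hD] at h
      simp only [hA, mem_filter, memR] at h ⊢
      refine ⟨?_, ⟨t, ?_⟩⟩
      · rw [← h, hab]; ring
      · rw [hab]; ring
    · rintro ⟨s, t⟩ _ ⟨s', t'⟩ _ h
      simp only [Prod.mk.injEq] at h
      have e1 : (p : ℤ) * s = p * s' := by
        rw [hab]; linear_combination a * h.1 + D * b * h.2
      have e2 : (p : ℤ) * t = p * t' := by
        rw [hab]; linear_combination a * h.2 - b * h.1
      rw [mul_left_cancel₀ hp0 e1, mul_left_cancel₀ hp0 e2]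
    · rintro ⟨x, y⟩ h
      simp only [hA, mem_filter, memR] at h
      obtain ⟨h, t, ht⟩ := h
      have : (p : ℤ) ∣ a * x + D * b * y := by
        refine (hpp.dvd_or_dvd (a := b) ?_).resolve_left hb
        refine ⟨y - a * t, ?_⟩
        linear_combination (-a) * ht - y * hab
      obtain ⟨s, hs⟩ := this
      have e1 : a * s - D * b * t = x := by
        apply mul_left_cancel₀ hp0
        linear_combination (-a) * hs + D * b * ht - x * hab
      have e2 : a * t + b * s = y := by
        apply mul_left_cancel₀ hp0
        linear_combination (-a) * ht - b * hs - y * hab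
      refine ⟨(s, t), ?_, by simp [e1, e2]⟩
      rw [mem_normReps hD]
      apply mul_left_cancel₀ hp0
      rw [← h, ← e1, ← e2, hab]; ring
  have hun : A ∪ B = R := by
    rw [hA, hB, ← filter_or, filter_true_of_mem]
    rintro ⟨x, y⟩ h
    rw [memR] at h
    apply hpp.dvd_or_dvd
    refine ⟨y ^ 2 - b ^ 2 * m, ?_⟩
    linear_combination (-b ^ 2) * h - y ^ 2 * hab
  have hABinter : A ∩ B = R.filter fun v => (p : ℤ) ∣ v.1 ∧ (p : ℤ) ∣ v.2 := by
    rw [hA, hB, ← filter_and]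
    refine filter_congr ?_
    rintro ⟨x, y⟩ _
    constructor
    · rintro ⟨h, h'⟩
      constructor
      · refine (hpp.dvd_or_dvd (a := 2 * b) ?_).resolve_left fun hh =>
          (hpp.dvd_or_dvd hh).elim h2' hb
        convert dvd_sub h' h using 1; ring
      · refine (hpp.dvd_or_dvd (a := 2 * a) ?_).resolve_left fun hh =>
          (hpp.dvd_or_dvd hh).elim h2' ha
        convert dvd_add h' h using 1; ring
    · rintro ⟨h, h'⟩
      exact ⟨dvd_sub (h'.mul_left _) (h.mul_left _), dvd_add (h'.mul_left _) (h.mul_left _)⟩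
  have key := card_union_add_card_inter A B
  rw [hun, hABinter] at key
  have key' : ((#R : ℤ)) + #(R.filter fun v => (p : ℤ) ∣ v.1 ∧ (p : ℤ) ∣ v.2) = #A + #B := by
    exact_mod_cast key
  rw [hR, normCount_multiples hD hp.ne_zero, ← hR, ← hAB, hAm] at key'
  rw [normCount, ← hR, normCount]
  linarith

/-- Sum of a completely multiplicative function over the divisors of `p * m`. -/
lemma sum_divisors_prime_mul {χ : ℕ → ℤ} (hχ : ∀ a b, χ (a * b) = χ a * χ b) {p : ℕ}
    (hp : p.Prime) {m : ℕ} (hm : m ≠ 0) :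
    ∑ d ∈ (p * m).divisors, χ d = (1 + χ p) * ∑ d ∈ m.divisors, χ d -
      χ p * if p ∣ m then ∑ d ∈ (m / p).divisors, χ d else 0 := by
  have mult : ∀ k : ℕ, k ≠ 0 →
      ∑ d ∈ (p * k).divisors.filter (fun d => p ∣ d), χ d = χ p * ∑ d ∈ k.divisors, χ d := by
    intro k hk
    rw [mul_sum]
    symm
    refine sum_bij (fun d _ => p * d) ?_ ?_ ?_ ?_
    · intro d hd
      simp only [mem_filter, Nat.mem_divisors] at hd ⊢
      exact ⟨⟨mul_dvd_mul_left p hd.1, mul_ne_zero hp.ne_zero hk⟩, dvd_mul_right _ _⟩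
    · intro d _ d' _ h
      exact Nat.eq_of_mul_eq_mul_left hp.pos h
    · intro d hd
      simp only [mem_filter, Nat.mem_divisors] at hd
      obtain ⟨⟨h1, h2⟩, c, rfl⟩ := hd
      exact ⟨c, Nat.mem_divisors.mpr ⟨Nat.dvd_of_mul_dvd_mul_left hp.pos h1, hk⟩, rfl⟩
    · intro d _
      exact (hχ p d).symm
  have hsame : (p * m).divisors.filter (fun d => ¬ p ∣ d) =
      m.divisors.filter (fun d => ¬ p ∣ d) := by
    ext d
    simp only [mem_filter, Nat.mem_divisors, ne_eq, mul_eq_zero, hp.ne_zero, hm, or_self,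
      not_false_eq_true, and_true, and_congr_left_iff]
    intro hd
    exact ⟨fun h => (((hp.coprime_iff_not_dvd).mpr hd).symm).dvd_of_dvd_mul_left h,
      fun h => h.mul_left _⟩
  have hdiv : ∑ d ∈ m.divisors.filter (fun d => p ∣ d), χ d =
      χ p * if p ∣ m then ∑ d ∈ (m / p).divisors, χ d else 0 := by
    split_ifs with h
    · obtain ⟨k, rfl⟩ := h
      rw [Nat.mul_div_cancel_left _ hp.pos, mult k (right_ne_zero_of_mul hm)]
    · rw [mul_zero, filter_eq_empty_iff.mpr, sum_empty]
      intro d hd h'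
      exact h (h'.trans (Nat.dvd_of_mem_divisors hd))
  rw [← sum_filter_add_sum_filter_not _ (fun d => p ∣ d), mult m hm, hsame, ← hdiv,
    ← sum_filter_add_sum_filter_not m.divisors (fun d => p ∣ d)]
  ring

/-- Dirichlet's formula for the number of representations of an odd number by `x² + D·y²`, given
the splitting behaviour of the odd primes. -/
lemma normCount_eq_of_primes {D : ℤ} (hD : 1 ≤ D) {χ : ℕ → ℤ} (hone : χ 1 = 1)
    (hχ : ∀ a b, χ (a * b) = χ a * χ b)
    (hprime : ∀ p : ℕ, p.Prime → p ≠ 2 → ¬ (p : ℤ) ∣ D ∧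
      ((χ p = 1 ∧ ∃ a b : ℤ, (p : ℤ) = a ^ 2 + D * b ^ 2) ∨
      (χ p = -1 ∧ ∀ x y : ℤ, (p : ℤ) ∣ x ^ 2 + D * y ^ 2 → (p : ℤ) ∣ x ∧ (p : ℤ) ∣ y)))
    (n : ℕ) (hn : Odd n) :
    normCount D n = normCount D 1 * ∑ d ∈ n.divisors, χ d := by
  induction n using Nat.strong_induction_on with
  | _ n ih =>
    rcases eq_or_ne n 1 with rfl | h1
    · simp [hone]
    obtain ⟨p, hp, m, rfl⟩ := Nat.exists_prime_and_dvd h1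
    have hpo := (Nat.odd_mul.mp hn).1
    have hmo := (Nat.odd_mul.mp hn).2
    have hm0 : m ≠ 0 := by rintro rfl; simp at hmo
    have hlt : m < p * m := lt_mul_left (Nat.pos_of_ne_zero hm0) hp.one_lt
    have h2 : p ≠ 2 := by intro h; rw [h] at hpo; exact absurd hpo (by decide)
    have ihm := ih m hlt hmo
    have ihd : (if p ∣ m then normCount D (m / p) else 0) =
        normCount D 1 * if p ∣ m then ∑ d ∈ (m / p).divisors, χ d else 0 := by
      split_ifs with h
      · obtain ⟨k, hk⟩ := h
        have : m / p = k := by rw [hk, Nat.mul_div_cancel_left _ hp.pos]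
        rw [this]
        rw [hk] at hmo
        refine ih k (lt_of_le_of_lt ?_ hlt) (Nat.odd_mul.mp hmo).2
        rw [hk]; exact Nat.le_mul_of_pos_left _ hp.pos
      · simp
    obtain ⟨hpD, ⟨hc, a, b, hab⟩ | ⟨hc, hin⟩⟩ := hprime p hp h2
    · rw [normCount_mul_of_split hD hp h2 hpD hab, sum_divisors_prime_mul hχ hp hm0, ihd, ihm, hc]
      ring
    · rw [normCount_mul_of_inert hD hp hin, sum_divisors_prime_mul hχ hp hm0, ihd, hc]
      ring

lemma dvd_of_dvd_sq_add_mul_sq {D : ℤ} {p : ℕ} (hp : p.Prime)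
    (hD : ¬ IsSquare (-D : ZMod p)) {x y : ℤ} (h : (p : ℤ) ∣ x ^ 2 + D * y ^ 2) :
    (p : ℤ) ∣ x ∧ (p : ℤ) ∣ y := by
  have := Fact.mk hp
  have h' : (x : ZMod p) ^ 2 + D * (y : ZMod p) ^ 2 = 0 := by
    have := (ZMod.intCast_zmod_eq_zero_iff_dvd (x ^ 2 + D * y ^ 2) p).mpr h
    push_cast at this
    exact this
  have hy : (y : ZMod p) = 0 := by
    by_contra hy
    apply hD
    refine ⟨x / y, ?_⟩
    field_simp
    linear_combination -h'
  have hx : (x : ZMod p) = 0 := by simpa [hy] using h'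
  exact ⟨(ZMod.intCast_zmod_eq_zero_iff_dvd x p).mp hx,
    (ZMod.intCast_zmod_eq_zero_iff_dvd y p).mp hy⟩

/-- Thue's lemma: every residue `s` modulo a prime is a quotient of two integers of absolute value
below the square root of the modulus. -/
lemma exists_sq_lt_prime_and_eq_mul {p : ℕ} (hp : p.Prime) (s : ZMod p) :
    ∃ x y : ℤ, x ^ 2 < p ∧ y ^ 2 < p ∧ (x ≠ 0 ∨ y ≠ 0) ∧ (x : ZMod p) = s * y := by
  have := Fact.mk hp
  set r := Nat.sqrt p with hr
  have hrp : r * r < p := by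
    refine lt_of_le_of_ne (Nat.sqrt_le p) fun h => ?_
    exact hp.prime.not_isSquare ⟨r, h.symm⟩
  have hcard : #(univ : Finset (ZMod p)) < #(range (r + 1) ×ˢ range (r + 1)) := by
    rw [card_univ, ZMod.card, card_product, card_range]
    exact Nat.lt_succ_sqrt p
  obtain ⟨⟨a, b⟩, hab, ⟨c, d⟩, hcd, hne, heq⟩ := exists_ne_map_eq_of_card_lt_of_maps_to hcard
    (f := fun v : ℕ × ℕ => (v.1 : ZMod p) - s * v.2) (fun _ _ => mem_coe.mpr (mem_univ _))
  simp only [mem_product, mem_range] at hab hcd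
  have bound : ∀ u v : ℕ, u < r + 1 → v < r + 1 → ((u : ℤ) - v) ^ 2 < p := by
    intro u v hu hv
    have h1 : |(u : ℤ) - v| ≤ r := by rw [abs_le]; constructor <;> omega
    have h2 : (r : ℤ) * r < p := by exact_mod_cast hrp
    have h3 := abs_nonneg ((u : ℤ) - v)
    rw [← sq_abs]
    nlinarith
  refine ⟨a - c, b - d, bound a c hab.1 hcd.1, bound b d hab.2 hcd.2, ?_, ?_⟩
  · by_contra! h
    apply hne
    simp only [Prod.mk.injEq]
    omega
  · push_cast
    linear_combination heq

lemma exists_eq_sq_add_two_mul_sq {p : ℕ} (hp : p.Prime)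
    (hsq : IsSquare (-2 : ZMod p)) : ∃ a b : ℤ, (p : ℤ) = a ^ 2 + 2 * b ^ 2 := by
  have := Fact.mk hp
  obtain ⟨s, hs⟩ := hsq
  obtain ⟨x, y, hx, hy, hxy, h⟩ := exists_sq_lt_prime_and_eq_mul hp s
  have hdvd : (p : ℤ) ∣ x ^ 2 + 2 * y ^ 2 := by
    rw [← ZMod.intCast_zmod_eq_zero_iff_dvd]
    push_cast
    rw [h]
    linear_combination (-(y : ZMod p) ^ 2) * hs
  obtain ⟨k, hk⟩ := hdvd
  have hpos : 0 < x ^ 2 + 2 * y ^ 2 := by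
    rcases hxy with h0 | h0
    · have := pow_pos (abs_pos.mpr h0) 2; rw [sq_abs] at this; nlinarith [sq_nonneg y]
    · have := pow_pos (abs_pos.mpr h0) 2; rw [sq_abs] at this; nlinarith [sq_nonneg x]
  have hp0 : (0 : ℤ) < p := by exact_mod_cast hp.pos
  have hk0 : 0 < k := by
    by_contra! hneg
    nlinarith
  have hk3 : k < 3 := by
    by_contra! hge
    nlinarith
  interval_cases k
  · exact ⟨x, y, by linarith⟩
  · have hev : Even x := by
      have : Even (x ^ 2) := ⟨p - y ^ 2, by linarith⟩
      exact (Int.even_pow.mp this).1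
    obtain ⟨t, rfl⟩ := hev
    exact ⟨y, t, by linarith⟩

lemma prime_splitting_one (p : ℕ) (hp : p.Prime) (h2 : p ≠ 2) : ¬ (p : ℤ) ∣ 1 ∧
    ((ZMod.χ₄ (p : ZMod 4) = 1 ∧ ∃ a b : ℤ, (p : ℤ) = a ^ 2 + 1 * b ^ 2) ∨
    (ZMod.χ₄ (p : ZMod 4) = -1 ∧
      ∀ x y : ℤ, (p : ℤ) ∣ x ^ 2 + 1 * y ^ 2 → (p : ℤ) ∣ x ∧ (p : ℤ) ∣ y)) := by
  have := Fact.mk hp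
  refine ⟨fun h => (Nat.prime_iff_prime_int.mp hp).not_isUnit (isUnit_of_dvd_one h), ?_⟩
  have hodd : p % 2 = 1 := (hp.eq_two_or_odd).resolve_left h2
  by_cases h4 : p % 4 = 3
  · right
    refine ⟨ZMod.χ₄_nat_three_mod_four h4, fun x y => dvd_of_dvd_sq_add_mul_sq hp ?_⟩
    intro h
    exact ZMod.exists_sq_eq_neg_one_iff.mp (by simpa using h) h4
  · left
    refine ⟨ZMod.χ₄_nat_one_mod_four (by omega), ?_⟩
    obtain ⟨a, b, hab⟩ := Nat.Prime.sq_add_sq h4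
    exact ⟨a, b, by rw [← hab]; push_cast; ring⟩

lemma prime_splitting_two (p : ℕ) (hp : p.Prime) (h2 : p ≠ 2) : ¬ (p : ℤ) ∣ 2 ∧
    ((ZMod.χ₈' (p : ZMod 8) = 1 ∧ ∃ a b : ℤ, (p : ℤ) = a ^ 2 + 2 * b ^ 2) ∨
    (ZMod.χ₈' (p : ZMod 8) = -1 ∧
      ∀ x y : ℤ, (p : ℤ) ∣ x ^ 2 + 2 * y ^ 2 → (p : ℤ) ∣ x ∧ (p : ℤ) ∣ y)) := by
  have := Fact.mk hp
  refine ⟨fun h => h2 ((Nat.prime_dvd_prime_iff_eq hp Nat.prime_two).mp (by exact_mod_cast h)), ?_⟩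
  have hodd : p % 2 = 1 := (hp.eq_two_or_odd).resolve_left h2
  by_cases h8 : p % 8 = 1 ∨ p % 8 = 3
  · left
    refine ⟨?_, exists_eq_sq_add_two_mul_sq hp ((ZMod.exists_sq_eq_neg_two_iff h2).mpr h8)⟩
    rw [ZMod.χ₈'_nat_eq_if_mod_eight, if_neg (by omega), if_pos h8]
  · right
    refine ⟨?_, fun x y => dvd_of_dvd_sq_add_mul_sq hp ?_⟩
    · rw [ZMod.χ₈'_nat_eq_if_mod_eight, if_neg (by omega), if_neg h8]
    · intro h
      exact h8 ((ZMod.exists_sq_eq_neg_two_iff h2).mp (by simpa using h))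

lemma normCount_one_one : normCount 1 1 = 4 := by
  have : normReps 1 1 = {(1, 0), (-1, 0), (0, 1), (0, -1)} := by
    ext ⟨x, y⟩
    rw [mem_normReps le_rfl]
    simp only [mem_insert, mem_singleton, Prod.mk.injEq]
    constructor
    · intro h
      have hx : x ^ 2 ≤ 1 := by nlinarith [sq_nonneg y]
      have hy : y ^ 2 ≤ 1 := by nlinarith [sq_nonneg x]
      obtain ⟨hx1, hx2⟩ := abs_le.mp ((sq_le_one_iff_abs_le_one x).mp hx)
      obtain ⟨hy1, hy2⟩ := abs_le.mp ((sq_le_one_iff_abs_le_one y).mp hy)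
      interval_cases x <;> interval_cases y <;> simp_all
    · rintro (⟨rfl, rfl⟩ | ⟨rfl, rfl⟩ | ⟨rfl, rfl⟩ | ⟨rfl, rfl⟩) <;> norm_num
  rw [normCount, Nat.cast_one, this]
  decide

lemma normCount_two_one : normCount 2 1 = 2 := by
  have : normReps 2 1 = {(1, 0), (-1, 0)} := by
    ext ⟨x, y⟩
    rw [mem_normReps (by norm_num)]
    simp only [mem_insert, mem_singleton, Prod.mk.injEq]
    constructor
    · intro h
      have hx : x ^ 2 ≤ 1 := by nlinarith [sq_nonneg y]
      have hy : y ^ 2 ≤ 1 := by nlinarith [sq_nonneg x]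
      obtain ⟨hx1, hx2⟩ := abs_le.mp ((sq_le_one_iff_abs_le_one x).mp hx)
      obtain ⟨hy1, hy2⟩ := abs_le.mp ((sq_le_one_iff_abs_le_one y).mp hy)
      interval_cases x <;> interval_cases y <;> simp_all
    · rintro (⟨rfl, rfl⟩ | ⟨rfl, rfl⟩) <;> norm_num
  rw [normCount, Nat.cast_one, this]
  decide

/-- Jacobi's two-square theorem for odd numbers. -/
lemma normCount_one_eq (n : ℕ) (hn : Odd n) :
    normCount 1 n = 4 * ∑ d ∈ n.divisors, ZMod.χ₄ (d : ZMod 4) := by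
  rw [← normCount_one_one]
  exact normCount_eq_of_primes le_rfl (χ := fun d => ZMod.χ₄ (d : ZMod 4)) (by simp)
    (fun a b => by simp only [Nat.cast_mul, map_mul]) prime_splitting_one n hn

lemma normCount_two_eq (n : ℕ) (hn : Odd n) :
    normCount 2 n = 2 * ∑ d ∈ n.divisors, ZMod.χ₈' (d : ZMod 8) := by
  rw [← normCount_two_one]
  exact normCount_eq_of_primes (by norm_num) (χ := fun d => ZMod.χ₈' (d : ZMod 8)) (by simp)
    (fun a b => by simp only [Nat.cast_mul, map_mul]) prime_splitting_two n hn

/-- The pairs of products `d·x`, `e·y` of integers of equal sign that add up to `N`, where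
`d ≡ e ≡ 3`, `x ≡ 1`, `y ≡ 7` modulo 8. -/
noncomputable def productPairs (N : ℤ) : Finset (ℤ × ℤ × ℤ × ℤ) :=
  (Icc (-N) N ×ˢ Icc (-N) N ×ˢ Icc (-N) N ×ˢ Icc (-N) N).filter fun q =>
    (q.1 % 8 = 3 ∧ q.2.1 % 8 = 1 ∧ q.2.2.1 % 8 = 3 ∧ q.2.2.2 % 8 = 7) ∧
      0 < q.1 * q.2.1 ∧ 0 < q.2.2.1 * q.2.2.2 ∧ q.1 * q.2.1 + q.2.2.1 * q.2.2.2 = N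

lemma mem_Icc_of_mul_pos {a b N : ℤ} (h : 0 < a * b) (hN : a * b ≤ N) :
    a ∈ Icc (-N) N ∧ b ∈ Icc (-N) N := by
  have ha : a ≠ 0 := by rintro rfl; simp at h
  have hb : b ≠ 0 := by rintro rfl; simp at h
  have h1 := Int.one_le_abs ha
  have h2 := Int.one_le_abs hb
  have h3 : |a| * |b| ≤ N := by rw [← abs_mul, abs_of_pos h]; exact hN
  rw [mem_Icc, mem_Icc, ← abs_le, ← abs_le]
  constructor <;> nlinarith

lemma mem_productPairs {N d x e y : ℤ} :
    (d, x, e, y) ∈ productPairs N ↔ (d % 8 = 3 ∧ x % 8 = 1 ∧ e % 8 = 3 ∧ y % 8 = 7) ∧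
      0 < d * x ∧ 0 < e * y ∧ d * x + e * y = N := by
  simp only [productPairs, mem_filter, mem_product, and_iff_right_iff_imp]
  rintro ⟨-, h1, h2, h3⟩
  obtain ⟨hd, hx⟩ := mem_Icc_of_mul_pos (N := N) h1 (by linarith)
  obtain ⟨he, hy⟩ := mem_Icc_of_mul_pos (N := N) h2 (by linarith)
  exact ⟨hd, hx, he, hy⟩

/-- The off-diagonal members of `productPairs`. -/
noncomputable def offDiagPairs (N : ℤ) : Finset (ℤ × ℤ × ℤ × ℤ) :=
  (productPairs N).filter fun q => q.1 ≠ q.2.2.1 ∧ q.2.1 + q.2.2.2 ≠ 0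

/-- Translation by `k` steps along the line on which `d - e`, `x + y` and `d·x + e·y` are
constant. -/
def lineShift (k : ℤ) (q : ℤ × ℤ × ℤ × ℤ) : ℤ × ℤ × ℤ × ℤ :=
  (q.1 - k * (q.1 - q.2.2.1), q.2.1 + k * (q.2.1 + q.2.2.2),
    q.2.2.1 - k * (q.1 - q.2.2.1), q.2.2.2 - k * (q.2.1 + q.2.2.2))

lemma lineShift_lineShift (k l : ℤ) (q : ℤ × ℤ × ℤ × ℤ) :
    lineShift k (lineShift l q) = lineShift (k + l) q := by
  simp only [lineShift, Prod.mk.injEq]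
  refine ⟨?_, ?_, ?_, ?_⟩ <;> ring

lemma lineShift_zero (q : ℤ × ℤ × ℤ × ℤ) : lineShift 0 q = q := by
  simp [lineShift]

/-- The number of steps after which `d` and `e` have opposite signs. -/
def stepsToOpposite (q : ℤ × ℤ × ℤ × ℤ) : ℤ := q.2.2.1.fdiv (q.1 - q.2.2.1) + 1

/-- The number of steps after which `x` and `y` have the same sign. -/
def stepsToEqual (q : ℤ × ℤ × ℤ × ℤ) : ℤ := -q.2.1.fdiv (q.2.1 + q.2.2.2)

lemma stepsToOpposite_lineShift {k : ℤ} {q : ℤ × ℤ × ℤ × ℤ} (h : q.1 ≠ q.2.2.1) :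
    stepsToOpposite (lineShift k q) = stepsToOpposite q - k := by
  have h' : q.1 - q.2.2.1 ≠ 0 := sub_ne_zero.mpr h
  simp only [stepsToOpposite, lineShift, sub_sub_sub_cancel_right]
  rw [Int.sub_mul_fdiv_right _ _ h']
  ring

lemma stepsToEqual_lineShift {k : ℤ} {q : ℤ × ℤ × ℤ × ℤ} (h : q.2.1 + q.2.2.2 ≠ 0) :
    stepsToEqual (lineShift k q) = stepsToEqual q - k := by
  have e : q.2.1 + k * (q.2.1 + q.2.2.2) + (q.2.2.2 - k * (q.2.1 + q.2.2.2)) =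
    q.2.1 + q.2.2.2 := by ring
  simp only [stepsToEqual, lineShift, e]
  rw [Int.add_mul_fdiv_right _ _ h]
  ring

lemma fdiv_eq_of_pos {a b k : ℤ} (hb : 0 < b) (h1 : b * k ≤ a) (h2 : a < b * (k + 1)) :
    a.fdiv b = k := by
  rw [Int.fdiv_eq_ediv_of_nonneg _ hb.le]
  apply le_antisymm
  · exact Int.lt_add_one_iff.mp (Int.ediv_lt_of_lt_mul hb (by linarith))
  · exact Int.le_ediv_of_mul_le hb (by linarith)

lemma fdiv_eq_of_neg {a b k : ℤ} (hb : b < 0) (h1 : a ≤ b * k) (h2 : b * (k + 1) < a) :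
    a.fdiv b = k := by
  rw [← Int.neg_fdiv_neg]
  exact fdiv_eq_of_pos (by linarith) (by linarith) (by linarith)

lemma fdiv_spec_of_pos {a b : ℤ} (hb : 0 < b) :
    b * a.fdiv b ≤ a ∧ a < b * (a.fdiv b + 1) := by
  rw [Int.fdiv_eq_ediv_of_nonneg _ hb.le]
  have h1 := Int.emod_nonneg a hb.ne'
  have h2 := Int.emod_lt_of_pos a hb
  have h3 := Int.mul_ediv_add_emod a b
  constructor <;> nlinarith

lemma fdiv_spec_of_neg {a b : ℤ} (hb : b < 0) :
    a ≤ b * a.fdiv b ∧ b * (a.fdiv b + 1) < a := by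
  rw [← Int.neg_fdiv_neg]
  obtain ⟨h1, h2⟩ := fdiv_spec_of_pos (a := -a) (b := -b) (by linarith)
  constructor <;> linarith

lemma stepsToEqual_eq_zero {q : ℤ × ℤ × ℤ × ℤ} (h : 0 < q.2.1 * q.2.2.2) :
    stepsToEqual q = 0 := by
  rw [stepsToEqual, neg_eq_zero]
  rcases mul_pos_iff.mp h with ⟨h1, h2⟩ | ⟨h1, h2⟩
  · exact fdiv_eq_of_pos (by linarith) (by linarith) (by linarith)
  · exact fdiv_eq_of_neg (by linarith) (by linarith) (by linarith)

lemma stepsToOpposite_eq_zero {q : ℤ × ℤ × ℤ × ℤ} (h : q.1 * q.2.2.1 < 0) :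
    stepsToOpposite q = 0 := by
  rw [stepsToOpposite, add_eq_zero_iff_eq_neg]
  rcases mul_neg_iff.mp h with ⟨h1, h2⟩ | ⟨h1, h2⟩
  · exact fdiv_eq_of_pos (by linarith) (by linarith) (by linarith)
  · exact fdiv_eq_of_neg (by linarith) (by linarith) (by linarith)

lemma mem_offDiagPairs {N d x e y : ℤ} :
    (d, x, e, y) ∈ offDiagPairs N ↔
      ((d % 8 = 3 ∧ x % 8 = 1 ∧ e % 8 = 3 ∧ y % 8 = 7) ∧
      0 < d * x ∧ 0 < e * y ∧ d * x + e * y = N) ∧ d ≠ e ∧ x + y ≠ 0 := by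
  rw [offDiagPairs, mem_filter, mem_productPairs]

/-- Membership of a translate only requires checking signs. -/
lemma lineShift_mem_offDiagPairs {N k : ℤ} {q : ℤ × ℤ × ℤ × ℤ} (hq : q ∈ offDiagPairs N)
    (h1 : 0 < (lineShift k q).1 * (lineShift k q).2.1)
    (h2 : 0 < (lineShift k q).2.2.1 * (lineShift k q).2.2.2) :
    lineShift k q ∈ offDiagPairs N := by
  obtain ⟨d, x, e, y⟩ := q
  obtain ⟨⟨⟨hd, hx, he, hy⟩, -, -, hN⟩, hde, hxy⟩ := mem_offDiagPairs.mp hq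
  obtain ⟨s, hs⟩ : (8 : ℤ) ∣ d - e := by omega
  obtain ⟨t, ht⟩ : (8 : ℤ) ∣ x + y := by omega
  have hs' : k * (d - e) = 8 * (k * s) := by rw [hs]; ring
  have ht' : k * (x + y) = 8 * (k * t) := by rw [ht]; ring
  simp only [lineShift] at h1 h2 ⊢
  rw [mem_offDiagPairs]
  refine ⟨⟨⟨?_, ?_, ?_, ?_⟩, h1, h2, ?_⟩, ?_, ?_⟩
  · rw [hs']; omega
  · rw [ht']; omega
  · rw [hs']; omega
  · rw [ht']; omega
  · rw [← hN]; ring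
  · intro h; apply hde; linarith
  · intro h; apply hxy; linarith

lemma signs_lineShift_stepsToOpposite {N d x e y : ℤ} (hq : (d, x, e, y) ∈ offDiagPairs N)
    (hpos : 0 < d * e) :
    let q' := lineShift (stepsToOpposite (d, x, e, y)) (d, x, e, y)
    0 < q'.1 * q'.2.1 ∧ 0 < q'.2.2.1 * q'.2.2.2 ∧ q'.1 * q'.2.2.1 < 0 := by
  obtain ⟨⟨⟨hd, hx, he, hy⟩, hdx, hey, hN⟩, hde, hxy⟩ := mem_offDiagPairs.mp hq
  obtain ⟨s, hs⟩ : (8 : ℤ) ∣ d - e := by omega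
  simp only [lineShift, stepsToOpposite]
  set u := d - e with hu
  set v := x + y with hv
  set k := e.fdiv u with hk
  have hne : u * k ≠ e := by
    intro h
    have : e = 8 * (s * k) := by rw [← h, hs]; ring
    omega
  have hu0 : u ≠ 0 := sub_ne_zero.mpr hde
  have hd' : d = e + u := by rw [hu]; ring
  have hy' : y = v - x := by rw [hv]; ring
  suffices H : (0 < d - (k + 1) * u ∧ 0 < x + (k + 1) * v ∧ e - (k + 1) * u < 0 ∧
      y - (k + 1) * v < 0) ∨ (d - (k + 1) * u < 0 ∧ x + (k + 1) * v < 0 ∧ 0 < e - (k + 1) * u ∧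
      0 < y - (k + 1) * v) by
    rcases H with ⟨h1, h2, h3, h4⟩ | ⟨h1, h2, h3, h4⟩
    · exact ⟨mul_pos h1 h2, mul_pos_of_neg_of_neg h3 h4, mul_neg_of_pos_of_neg h1 h3⟩
    · exact ⟨mul_pos_of_neg_of_neg h1 h2, mul_pos h3 h4, mul_neg_of_neg_of_pos h1 h3⟩
  rcases lt_or_gt_of_ne hu0 with hun | hup
  · right
    obtain ⟨hk1, hk2⟩ := fdiv_spec_of_neg (a := e) hun
    rw [← hk] at hk1 hk2
    have hk1' := lt_of_le_of_ne hk1 hne.symm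
    rcases mul_pos_iff.mp hpos with ⟨h1, h2⟩ | ⟨h1, h2⟩
    · have hx0 : 0 < x := (pos_iff_pos_of_mul_pos hdx).mp h1
      have hy0 : 0 < y := (pos_iff_pos_of_mul_pos hey).mp h2
      have hkk : k + 1 < 0 := by
        by_contra! h
        nlinarith
      refine ⟨by linarith, ?_, by linarith, ?_⟩ <;> nlinarith
    · have hx0 : x < 0 := (neg_iff_neg_of_mul_pos hdx).mp h1
      have hy0 : y < 0 := (neg_iff_neg_of_mul_pos hey).mp h2
      have hkk : 0 < k + 1 := by
        by_contra! h
        nlinarith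
      refine ⟨by linarith, ?_, by linarith, ?_⟩ <;> nlinarith
  · left
    obtain ⟨hk1, hk2⟩ := fdiv_spec_of_pos (a := e) hup
    rw [← hk] at hk1 hk2
    have hk1' := lt_of_le_of_ne hk1 hne
    rcases mul_pos_iff.mp hpos with ⟨h1, h2⟩ | ⟨h1, h2⟩
    · have hx0 : 0 < x := (pos_iff_pos_of_mul_pos hdx).mp h1
      have hy0 : 0 < y := (pos_iff_pos_of_mul_pos hey).mp h2
      have hkk : 0 < k + 1 := by
        by_contra! h
        nlinarith
      refine ⟨by linarith, ?_, by linarith, ?_⟩ <;> nlinarith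
    · have hx0 : x < 0 := (neg_iff_neg_of_mul_pos hdx).mp h1
      have hy0 : y < 0 := (neg_iff_neg_of_mul_pos hey).mp h2
      have hkk : k + 1 < 0 := by
        by_contra! h
        nlinarith
      refine ⟨by linarith, ?_, by linarith, ?_⟩ <;> nlinarith

lemma signs_lineShift_stepsToEqual {N d x e y : ℤ} (hq : (d, x, e, y) ∈ offDiagPairs N)
    (hneg : d * e < 0) :
    let q' := lineShift (stepsToEqual (d, x, e, y)) (d, x, e, y)
    0 < q'.1 * q'.2.1 ∧ 0 < q'.2.2.1 * q'.2.2.2 ∧ 0 < q'.1 * q'.2.2.1 := by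
  obtain ⟨⟨⟨hd, hx, he, hy⟩, hdx, hey, hN⟩, hde, hxy⟩ := mem_offDiagPairs.mp hq
  obtain ⟨s, hs⟩ : (8 : ℤ) ∣ x + y := by omega
  simp only [lineShift, stepsToEqual]
  set u := d - e with hu
  set v := x + y with hv
  set k := x.fdiv v with hk
  have hne : v * k ≠ x := by
    intro h
    have : x = 8 * (s * k) := by rw [← h, hs]; ring
    omega
  suffices H : (0 < d - -k * u ∧ 0 < x + -k * v ∧ 0 < e - -k * u ∧
      0 < y - -k * v) ∨ (d - -k * u < 0 ∧ x + -k * v < 0 ∧ e - -k * u < 0 ∧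
      y - -k * v < 0) by
    rcases H with ⟨h1, h2, h3, h4⟩ | ⟨h1, h2, h3, h4⟩
    · exact ⟨mul_pos h1 h2, mul_pos h3 h4, mul_pos h1 h3⟩
    · exact ⟨mul_pos_of_neg_of_neg h1 h2, mul_pos_of_neg_of_neg h3 h4,
        mul_pos_of_neg_of_neg h1 h3⟩
  rcases lt_or_gt_of_ne hxy with hvn | hvp
  · right
    obtain ⟨hk1, hk2⟩ := fdiv_spec_of_neg (a := x) hvn
    rw [← hk] at hk1 hk2
    have hk1' := lt_of_le_of_ne hk1 hne.symm
    rcases mul_neg_iff.mp hneg with ⟨h1, h2⟩ | ⟨h1, h2⟩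
    · have hx0 : 0 < x := (pos_iff_pos_of_mul_pos hdx).mp h1
      have hy0 : y < 0 := (neg_iff_neg_of_mul_pos hey).mp h2
      have hkk : k < 0 := by
        by_contra! h
        nlinarith
      refine ⟨?_, by linarith, ?_, by linarith⟩ <;> nlinarith
    · have hx0 : x < 0 := (neg_iff_neg_of_mul_pos hdx).mp h1
      have hy0 : 0 < y := (pos_iff_pos_of_mul_pos hey).mp h2
      have hkk : 0 < k := by
        by_contra! h
        nlinarith
      refine ⟨?_, by linarith, ?_, by linarith⟩ <;> nlinarith
  · left
    obtain ⟨hk1, hk2⟩ := fdiv_spec_of_pos (a := x) hvp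
    rw [← hk] at hk1 hk2
    have hk1' := lt_of_le_of_ne hk1 hne
    rcases mul_neg_iff.mp hneg with ⟨h1, h2⟩ | ⟨h1, h2⟩
    · have hx0 : 0 < x := (pos_iff_pos_of_mul_pos hdx).mp h1
      have hy0 : y < 0 := (neg_iff_neg_of_mul_pos hey).mp h2
      have hkk : 0 < k := by
        by_contra! h
        nlinarith
      refine ⟨?_, by linarith, ?_, by linarith⟩ <;> nlinarith
    · have hx0 : x < 0 := (neg_iff_neg_of_mul_pos hdx).mp h1
      have hy0 : 0 < y := (pos_iff_pos_of_mul_pos hey).mp h2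
      have hkk : k < 0 := by
        by_contra! h
        nlinarith
      refine ⟨?_, by linarith, ?_, by linarith⟩ <;> nlinarith

lemma card_offDiagPairs_pos_eq_neg (N : ℤ) :
    #{q ∈ offDiagPairs N | 0 < q.1 * q.2.2.1} = #{q ∈ offDiagPairs N | q.1 * q.2.2.1 < 0} := by
  refine card_nbij' (fun q => lineShift (stepsToOpposite q) q)
    (fun q => lineShift (stepsToEqual q) q) ?_ ?_ ?_ ?_
  · rintro ⟨d, x, e, y⟩ hq
    simp only [coe_filter, Set.mem_ofPred_eq] at hq ⊢
    obtain ⟨h1, h2, h3⟩ := signs_lineShift_stepsToOpposite hq.1 hq.2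
    exact ⟨lineShift_mem_offDiagPairs hq.1 h1 h2, h3⟩
  · rintro ⟨d, x, e, y⟩ hq
    simp only [coe_filter, Set.mem_ofPred_eq] at hq ⊢
    obtain ⟨h1, h2, h3⟩ := signs_lineShift_stepsToEqual hq.1 hq.2
    exact ⟨lineShift_mem_offDiagPairs hq.1 h1 h2, h3⟩
  · rintro ⟨d, x, e, y⟩ hq
    simp only [coe_filter, Set.mem_ofPred_eq] at hq
    obtain ⟨⟨-, hdx, hey, -⟩, -, hxy⟩ := mem_offDiagPairs.mp hq.1
    have hxy' : 0 < x * y := by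
      rcases mul_pos_iff.mp hq.2 with ⟨h1, h2⟩ | ⟨h1, h2⟩
      · exact mul_pos ((pos_iff_pos_of_mul_pos hdx).mp h1) ((pos_iff_pos_of_mul_pos hey).mp h2)
      · exact mul_pos_of_neg_of_neg ((neg_iff_neg_of_mul_pos hdx).mp h1)
          ((neg_iff_neg_of_mul_pos hey).mp h2)
    simp only
    rw [stepsToEqual_lineShift hxy, stepsToEqual_eq_zero hxy', lineShift_lineShift,
      zero_sub, neg_add_cancel, lineShift_zero]
  · rintro ⟨d, x, e, y⟩ hq
    simp only [coe_filter, Set.mem_ofPred_eq] at hq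
    obtain ⟨-, hde, -⟩ := mem_offDiagPairs.mp hq.1
    simp only
    rw [stepsToOpposite_lineShift hde, stepsToOpposite_eq_zero hq.2, lineShift_lineShift,
      zero_sub, neg_add_cancel, lineShift_zero]

lemma sum_sign_offDiagPairs (N : ℤ) :
    ∑ q ∈ offDiagPairs N, (q.1 * q.2.2.1).sign = 0 := by
  have h : ∀ q ∈ offDiagPairs N, (q.1 * q.2.2.1).sign =
      (if 0 < q.1 * q.2.2.1 then 1 else 0) - (if q.1 * q.2.2.1 < 0 then 1 else 0) := by
    intro q _
    rcases lt_trichotomy (q.1 * q.2.2.1) 0 with h | h | h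
    · rw [Int.sign_eq_neg_one_of_neg h, if_neg h.not_gt, if_pos h]; rfl
    · rw [h]; rfl
    · rw [Int.sign_eq_one_of_pos h, if_pos h, if_neg h.not_gt]; rfl
  rw [sum_congr rfl h, sum_sub_distrib, sum_boole, sum_boole, card_offDiagPairs_pos_eq_neg,
    sub_self]

/-- The triples `(d, x, y)` of integers of equal sign with `d·(x + y) = 8n`, where `d ≡ r` and
`x ≡ s` modulo 8. -/
noncomputable def diagTriples (n : ℕ) (r s : ℤ) : Finset (ℤ × ℤ × ℤ) :=
  (Icc (-(8 * n : ℤ)) (8 * n) ×ˢ Icc (-(8 * n : ℤ)) (8 * n) ×ˢ Icc (-(8 * n : ℤ)) (8 * n)).filter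
    fun q => (q.1 % 8 = r ∧ q.2.1 % 8 = s) ∧
      0 < q.1 * q.2.1 ∧ 0 < q.1 * q.2.2 ∧ q.1 * (q.2.1 + q.2.2) = 8 * n

lemma mem_diagTriples {n : ℕ} {r s d x y : ℤ} :
    (d, x, y) ∈ diagTriples n r s ↔ (d % 8 = r ∧ x % 8 = s) ∧
      0 < d * x ∧ 0 < d * y ∧ d * (x + y) = 8 * n := by
  simp only [diagTriples, mem_filter, mem_product, and_iff_right_iff_imp]
  rintro ⟨-, h1, h2, h3⟩
  rw [mul_add] at h3
  obtain ⟨hd, hx⟩ := mem_Icc_of_mul_pos (N := 8 * n) h1 (by linarith)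
  obtain ⟨-, hy⟩ := mem_Icc_of_mul_pos (N := 8 * n) h2 (by linarith)
  exact ⟨hd, hx, hy⟩

lemma card_diagTriples {n : ℕ} (hn : n ≠ 0) {r s : ℤ} (hr : r = 1 ∨ r = 3)
    (hs : s = 1 ∨ s = 3) :
    #(diagTriples n r s) =
      ∑ d ∈ n.divisors.filter (fun d : ℕ => (d : ℤ) % 8 = r ∨ (d : ℤ) % 8 = 8 - r), n / d := by
  have hmaps : ∀ q ∈ diagTriples n r s, q.1.natAbs ∈
      n.divisors.filter (fun d : ℕ => (d : ℤ) % 8 = r ∨ (d : ℤ) % 8 = 8 - r) := by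
    rintro ⟨d, x, y⟩ h
    obtain ⟨⟨hd, hx⟩, h1, h2, h3⟩ := mem_diagTriples.mp h
    have hcop : IsCoprime d 8 := by
      have : IsCoprime d 2 := (Int.prime_two.coprime_iff_not_dvd.mpr (by omega)).symm
      simpa using this.pow_right (n := 3)
    have hdn : d ∣ n := hcop.dvd_of_dvd_mul_left (Dvd.intro _ h3)
    rw [mem_filter, Nat.mem_divisors]
    refine ⟨⟨Int.natAbs_dvd_natAbs.mpr hdn, hn⟩, ?_⟩
    simp only
    omega
  rw [card_eq_sum_card_fiberwise hmaps]
  refine sum_congr rfl fun d hd => ?_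
  rw [mem_filter, Nat.mem_divisors] at hd
  obtain ⟨⟨⟨m, rfl⟩, -⟩, hdr⟩ := hd
  have hd0 : 0 < d := Nat.pos_of_ne_zero (left_ne_zero_of_mul hn)
  have hd0' : (0 : ℤ) < d := by exact_mod_cast hd0
  rw [Nat.mul_div_cancel_left _ hd0]
  conv_rhs => rw [← card_range m]
  symm
  rcases hdr with hdr | hdr
  · refine card_bij (fun k _ => ((d : ℤ), 8 * (k : ℤ) + s, 8 * (m : ℤ) - (8 * k + s))) ?_ ?_ ?_
    · intro k hk
      rw [mem_range] at hk
      rw [mem_filter, mem_diagTriples]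
      refine ⟨⟨⟨hdr, by omega⟩, mul_pos hd0' (by omega), mul_pos hd0' (by omega), ?_⟩, by simp⟩
      push_cast; ring
    · intro k _ k' _ h
      simp only [Prod.mk.injEq] at h
      omega
    · rintro ⟨a, x, y⟩ h
      rw [mem_filter, mem_diagTriples] at h
      obtain ⟨⟨⟨ha, hx⟩, h1, h2, h3⟩, h4⟩ := h
      have had : a = d := by
        simp only at h4
        omega
      subst had
      have hx0 := (pos_iff_pos_of_mul_pos h1).mp hd0'
      have hy0 := (pos_iff_pos_of_mul_pos h2).mp hd0'
      have hxy : x + y = 8 * m := by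
        apply mul_left_cancel₀ hd0'.ne'
        rw [h3]; push_cast; ring
      refine ⟨((x - s) / 8).toNat, mem_range.mpr (by omega), ?_⟩
      simp only [Prod.mk.injEq, true_and]
      omega
  · refine card_bij (fun k _ => (-(d : ℤ), -(8 * (k : ℤ) + (8 - s)),
      -(8 * (m : ℤ) - (8 * k + (8 - s))))) ?_ ?_ ?_
    · intro k hk
      rw [mem_range] at hk
      rw [mem_filter, mem_diagTriples]
      refine ⟨⟨⟨by omega, by omega⟩, mul_pos_of_neg_of_neg (by omega) (by omega),
        mul_pos_of_neg_of_neg (by omega) (by omega), ?_⟩, by simp⟩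
      push_cast; ring
    · intro k _ k' _ h
      simp only [Prod.mk.injEq] at h
      omega
    · rintro ⟨a, x, y⟩ h
      rw [mem_filter, mem_diagTriples] at h
      obtain ⟨⟨⟨ha, hx⟩, h1, h2, h3⟩, h4⟩ := h
      have had : a = -d := by
        simp only at h4
        omega
      subst had
      have hd0'' : -(d : ℤ) < 0 := by linarith
      have hx0 := (neg_iff_neg_of_mul_pos h1).mp hd0''
      have hy0 := (neg_iff_neg_of_mul_pos h2).mp hd0''
      have hxy : x + y = -(8 * m) := by
        apply mul_left_cancel₀ hd0''.ne
        rw [h3]; push_cast; ring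
      refine ⟨((-x - (8 - s)) / 8).toNat, mem_range.mpr (by omega), ?_⟩
      simp only [Prod.mk.injEq, true_and]
      omega

lemma sum_sign_diag_eq {n : ℕ} :
    ∑ q ∈ productPairs (8 * n) with q.1 = q.2.2.1, (q.1 * q.2.2.1).sign =
      #(diagTriples n 3 1) := by
  rw [card_eq_sum_ones, Nat.cast_sum]
  refine sum_bij' (fun q _ => (q.1, q.2.1, q.2.2.2)) (fun q _ => (q.1, q.2.1, q.1, q.2.2))
    ?_ ?_ ?_ ?_ ?_
  · rintro ⟨d, x, e, y⟩ h
    rw [mem_filter, mem_productPairs] at h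
    obtain ⟨⟨⟨hd, hx, he, hy⟩, h1, h2, h3⟩, h4⟩ := h
    simp only at h4
    subst h4
    exact mem_diagTriples.mpr ⟨⟨hd, hx⟩, h1, h2, by linarith⟩
  · rintro ⟨d, x, y⟩ h
    obtain ⟨⟨hd, hx⟩, h1, h2, h3⟩ := mem_diagTriples.mp h
    rw [mem_filter, mem_productPairs]
    refine ⟨⟨⟨hd, hx, hd, ?_⟩, h1, h2, by linarith⟩, rfl⟩
    have h8 : (8 : ℤ) ∣ x + y := by
      have hcop : IsCoprime (8 : ℤ) d := by
        have : IsCoprime (2 : ℤ) d := Int.prime_two.coprime_iff_not_dvd.mpr (by omega)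
        simpa using this.pow_left (m := 3)
      exact hcop.dvd_of_dvd_mul_left (Dvd.intro _ h3.symm)
    simp only
    omega
  · rintro ⟨d, x, e, y⟩ h
    rw [mem_filter] at h
    obtain ⟨-, h4⟩ := h
    simp only at h4
    rw [h4]
  · rintro ⟨d, x, y⟩ _
    rfl
  · rintro ⟨d, x, e, y⟩ h
    rw [mem_filter, mem_productPairs] at h
    obtain ⟨⟨⟨hd, -⟩, -⟩, h4⟩ := h
    simp only at h4 ⊢
    rw [← h4, Int.sign_eq_one_of_pos (mul_self_pos.mpr (by rintro rfl; simp at hd))]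
    rfl

lemma sum_sign_antidiag_eq {n : ℕ} :
    ∑ q ∈ productPairs (8 * n) with q.2.1 + q.2.2.2 = 0, (q.1 * q.2.2.1).sign =
      -#(diagTriples n 1 3) := by
  rw [card_eq_sum_ones, Nat.cast_sum, ← sum_neg_distrib]
  refine sum_bij' (fun q _ => (q.2.1, q.1, -q.2.2.1)) (fun q _ => (q.2.1, q.1, -q.2.2, -q.1))
    ?_ ?_ ?_ ?_ ?_
  · rintro ⟨d, x, e, y⟩ h
    rw [mem_filter, mem_productPairs] at h
    obtain ⟨⟨⟨hd, hx, he, hy⟩, h1, h2, h3⟩, h4⟩ := h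
    simp only at h4
    obtain rfl : y = -x := by linarith
    exact mem_diagTriples.mpr ⟨⟨hx, hd⟩, by linarith, by linarith, by linarith⟩
  · rintro ⟨x, d, e⟩ h
    obtain ⟨⟨hx, hd⟩, h1, h2, h3⟩ := mem_diagTriples.mp h
    rw [mem_filter, mem_productPairs]
    have h8 : (8 : ℤ) ∣ d + e := by
      have hcop : IsCoprime (8 : ℤ) x := by
        have : IsCoprime (2 : ℤ) x := Int.prime_two.coprime_iff_not_dvd.mpr (by omega)
        simpa using this.pow_left (m := 3)
      exact hcop.dvd_of_dvd_mul_left (Dvd.intro _ h3.symm)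
    refine ⟨⟨⟨hd, hx, ?_, ?_⟩, ?_, ?_, ?_⟩, ?_⟩ <;> simp only
    · omega
    · omega
    · linarith
    · linarith
    · linarith
    · ring
  · rintro ⟨d, x, e, y⟩ h
    rw [mem_filter] at h
    obtain ⟨-, h4⟩ := h
    simp only at h4
    obtain rfl : y = -x := by linarith
    simp
  · rintro ⟨x, d, e⟩ _
    simp
  · rintro ⟨d, x, e, y⟩ h
    rw [mem_filter, mem_productPairs] at h
    obtain ⟨⟨-, h1, h2, -⟩, h4⟩ := h
    simp only at h4 ⊢
    obtain rfl : y = -x := by linarith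
    have hneg : d * e < 0 := by
      rcases mul_pos_iff.mp h1 with ⟨h5, h6⟩ | ⟨h5, h6⟩
      · exact mul_neg_of_pos_of_neg h5 ((neg_iff_neg_of_mul_pos h2).mpr (by linarith))
      · exact mul_neg_of_neg_of_pos h5 ((pos_iff_pos_of_mul_pos h2).mpr (by linarith))
    rw [Int.sign_eq_neg_one_of_neg hneg]
    rfl

lemma sum_sign_productPairs {n : ℕ} (hn : n ≠ 0) :
    ∑ q ∈ productPairs (8 * n), (q.1 * q.2.2.1).sign =
      -∑ d ∈ n.divisors, chi8 ((n / d : ℕ) : ℤ) * (d : ℤ) := by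
  have hsplit : ∑ q ∈ productPairs (8 * n), (q.1 * q.2.2.1).sign =
      (#(diagTriples n 3 1) : ℤ) - #(diagTriples n 1 3) := by
    rw [← sum_filter_add_sum_filter_not _ (fun q => q.1 = q.2.2.1), sum_sign_diag_eq,
      ← sum_filter_add_sum_filter_not
        ((productPairs (8 * n)).filter (fun q => ¬ q.1 = q.2.2.1))
        (fun q => q.2.1 + q.2.2.2 = 0), filter_filter, filter_filter]
    have hoff := sum_sign_offDiagPairs (8 * n)
    rw [offDiagPairs] at hoff
    have hanti : (productPairs (8 * n)).filter
        (fun q => ¬ q.1 = q.2.2.1 ∧ q.2.1 + q.2.2.2 = 0) =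
        (productPairs (8 * n)).filter (fun q => q.2.1 + q.2.2.2 = 0) := by
      refine filter_congr ?_
      rintro ⟨d, x, e, y⟩ h
      obtain ⟨-, -, -, h3⟩ := mem_productPairs.mp h
      refine and_iff_right_of_imp fun h4 h5 => ?_
      simp only at h4 h5
      subst h5
      have : (8 : ℤ) * n = 0 := by
        rw [← h3, ← mul_add, h4, mul_zero]
      omega
    rw [hanti, sum_sign_antidiag_eq, hoff]
    ring
  rw [hsplit, card_diagTriples hn (Or.inr rfl) (Or.inl rfl),
    card_diagTriples hn (Or.inl rfl) (Or.inr rfl), ← Nat.sum_div_divisors, sum_filter, sum_filter]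
  rw [Nat.cast_sum, Nat.cast_sum, ← sum_sub_distrib, ← sum_neg_distrib]
  refine sum_congr rfl fun d hd => ?_
  rw [Nat.mem_divisors] at hd
  rw [Nat.div_div_self hd.1 hd.2, chi8]
  have h1 : ((d : ℤ) % 8 = 1 ∨ (d : ℤ) % 8 = 8 - 1) ↔ ((d : ℤ) % 8 = 1 ∨ (d : ℤ) % 8 = 7) := by
    norm_num
  have h2 : ((d : ℤ) % 8 = 3 ∨ (d : ℤ) % 8 = 8 - 3) ↔ ((d : ℤ) % 8 = 3 ∨ (d : ℤ) % 8 = 5) := by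
    norm_num
  simp only [h1, h2]
  split_ifs <;> omega

/-- The factorizations `m = d·x` over the integers with `d ≡ 3` and `x ≡ b` modulo 8. -/
noncomputable def factorPairs (m b : ℤ) : Finset (ℤ × ℤ) :=
  (Icc (-m) m ×ˢ Icc (-m) m).filter fun v => v.1 * v.2 = m ∧ v.1 % 8 = 3 ∧ v.2 % 8 = b

lemma mem_factorPairs {m b d x : ℤ} (hm : 0 < m) :
    (d, x) ∈ factorPairs m b ↔ d * x = m ∧ d % 8 = 3 ∧ x % 8 = b := by
  simp only [factorPairs, mem_filter, mem_product, and_iff_right_iff_imp]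
  rintro ⟨h, -⟩
  exact mem_Icc_of_mul_pos (h ▸ hm) h.le

/-- `1` on the class of 3, `-1` on the class of 5 modulo 8, and `0` elsewhere. -/
def threeSubFive (d : ℕ) : ℤ := if d % 8 = 3 then 1 else if d % 8 = 5 then -1 else 0

lemma sum_sign_factorPairs {m : ℕ} (hm : 0 < m) {b : ℤ} (hb : b = 1 ∨ b = 7)
    (hmb : (m : ℤ) % 8 = 3 * b % 8) :
    ∑ v ∈ factorPairs m b, v.1.sign = ∑ d ∈ m.divisors, threeSubFive d := by
  have hm' : (0 : ℤ) < m := by exact_mod_cast hm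
  have hrestrict : ∑ d ∈ m.divisors, threeSubFive d =
      ∑ d ∈ m.divisors with d % 8 = 3 ∨ d % 8 = 5, threeSubFive d := by
    rw [sum_filter]
    refine sum_congr rfl fun d _ => ?_
    rw [threeSubFive]
    split_ifs <;> first | rfl | omega
  rw [hrestrict]
  refine sum_bij (fun v _ => v.1.natAbs) ?_ ?_ ?_ ?_
  · rintro ⟨d, x⟩ h
    rw [mem_factorPairs hm'] at h
    rw [mem_filter, Nat.mem_divisors]
    refine ⟨⟨Int.natCast_dvd_natCast.mp (Int.natAbs_dvd.mpr (Dvd.intro _ h.1)), hm.ne'⟩, ?_⟩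
    simp only
    omega
  · rintro ⟨d, x⟩ h ⟨d', x'⟩ h' heq
    rw [mem_factorPairs hm'] at h h'
    simp only at heq
    have hd : d = d' := by omega
    subst hd
    have hd0 : d ≠ 0 := by rintro rfl; simp at h
    rw [mul_left_cancel₀ hd0 (h.1.trans h'.1.symm)]
  · intro d hd
    rw [mem_filter, Nat.mem_divisors] at hd
    obtain ⟨⟨⟨c, rfl⟩, -⟩, hd⟩ := hd
    push_cast at hmb
    rcases hd with hd | hd
    · refine ⟨((d : ℤ), (c : ℤ)), ?_, by simp⟩
      rw [mem_factorPairs hm']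
      refine ⟨by push_cast; rfl, by omega, ?_⟩
      rw [Int.mul_emod, show (d : ℤ) % 8 = 3 by omega] at hmb
      have h1 := Int.emod_lt_of_pos (c : ℤ) (by norm_num : (0 : ℤ) < 8)
      have h2 := Int.emod_nonneg (c : ℤ) (by norm_num : (8 : ℤ) ≠ 0)
      omega
    · refine ⟨(-(d : ℤ), -(c : ℤ)), ?_, by simp⟩
      rw [mem_factorPairs hm']
      refine ⟨by push_cast; ring, by omega, ?_⟩
      rw [Int.mul_emod, show (d : ℤ) % 8 = 5 by omega] at hmb
      have h1 := Int.emod_lt_of_pos (c : ℤ) (by norm_num : (0 : ℤ) < 8)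
      have h2 := Int.emod_nonneg (c : ℤ) (by norm_num : (8 : ℤ) ≠ 0)
      omega
  · rintro ⟨d, x⟩ h
    rw [mem_factorPairs hm'] at h
    simp only [threeSubFive]
    rcases lt_trichotomy d 0 with h0 | h0 | h0
    · rw [Int.sign_eq_neg_one_of_neg h0, if_neg (by omega), if_pos (by omega)]
    · subst h0; simp at h
    · rw [Int.sign_eq_one_of_pos h0, if_pos (by omega)]

lemma sum_divisors_χ₈' {m : ℕ} (hm : m % 8 = 3) :
    ∑ d ∈ m.divisors, ZMod.χ₈' (d : ZMod 8) = 2 * ∑ d ∈ m.divisors, threeSubFive d := by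
  rw [two_mul]
  nth_rw 3 [← Nat.sum_div_divisors]
  rw [← sum_add_distrib]
  refine sum_congr rfl fun d hd => ?_
  obtain ⟨⟨c, rfl⟩, h0⟩ := Nat.mem_divisors.mp hd
  rw [Nat.mul_div_cancel_left _ (Nat.pos_of_ne_zero (left_ne_zero_of_mul h0)),
    ZMod.χ₈'_nat_eq_if_mod_eight, threeSubFive, threeSubFive]
  rw [Nat.mul_mod] at hm
  have h1 := Nat.mod_lt d (by norm_num : 8 > 0)
  have h2 := Nat.mod_lt c (by norm_num : 8 > 0)
  have h3 : d % 2 = d % 8 % 2 := by omega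
  rw [h3]
  generalize d % 8 = a at *
  generalize c % 8 = b at *
  interval_cases a <;> interval_cases b <;> simp_all

lemma sum_divisors_χ₄ {m : ℕ} (hm : m % 8 = 5) :
    ∑ d ∈ m.divisors, ZMod.χ₄ (d : ZMod 4) = -(2 * ∑ d ∈ m.divisors, threeSubFive d) := by
  rw [two_mul]
  nth_rw 3 [← Nat.sum_div_divisors]
  rw [← sum_add_distrib, ← sum_neg_distrib]
  refine sum_congr rfl fun d hd => ?_
  obtain ⟨⟨c, rfl⟩, h0⟩ := Nat.mem_divisors.mp hd
  rw [Nat.mul_div_cancel_left _ (Nat.pos_of_ne_zero (left_ne_zero_of_mul h0)),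
    ZMod.χ₄_nat_eq_if_mod_four, threeSubFive, threeSubFive]
  rw [Nat.mul_mod] at hm
  have h1 := Nat.mod_lt d (by norm_num : 8 > 0)
  have h2 := Nat.mod_lt c (by norm_num : 8 > 0)
  have h3 : d % 2 = d % 8 % 2 := by omega
  have h4 : d % 4 = d % 8 % 4 := by omega
  rw [h3, h4]
  generalize d % 8 = a at *
  generalize c % 8 = b at *
  interval_cases a <;> interval_cases b <;> simp_all

/-- The triangular number `k(2k + 1)`; each triangular number arises from exactly one integer. -/
def tri (k : ℤ) : ℤ := 2 * k ^ 2 + k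

lemma tri_nonneg (k : ℤ) : 0 ≤ tri k := by
  rw [tri]
  rcases le_or_gt 0 k with h | h
  · positivity
  · nlinarith

lemma mem_Icc_of_tri_le {k i : ℤ} (h : tri k ≤ i) : k ∈ Icc (-i) i := by
  rw [tri] at h
  rw [mem_Icc]
  rcases le_or_gt 0 k with h0 | h0
  · constructor <;> nlinarith
  · constructor <;> nlinarith

/-- The integer solutions of `tri a + c · tri b = i`. -/
noncomputable def triReps (c i : ℤ) : Finset (ℤ × ℤ) :=
  (Icc (-i) i ×ˢ Icc (-i) i).filter fun v => tri v.1 + c * tri v.2 = i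

lemma mem_triReps {c i a b : ℤ} (hc : 1 ≤ c) :
    (a, b) ∈ triReps c i ↔ tri a + c * tri b = i := by
  simp only [triReps, mem_filter, mem_product, and_iff_right_iff_imp]
  intro h
  have ha := tri_nonneg a
  have hb := tri_nonneg b
  exact ⟨mem_Icc_of_tri_le (by nlinarith), mem_Icc_of_tri_le (by nlinarith)⟩

lemma exists_sign_mul_eq_of_odd {x : ℤ} (hx : x % 2 = 1) :
    ∃ k s : ℤ, (s = 1 ∨ s = -1) ∧ x = s * (4 * k + 1) := by
  rcases (by omega : x % 4 = 1 ∨ x % 4 = 3) with h | h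
  · exact ⟨(x - 1) / 4, 1, Or.inl rfl, by omega⟩
  · exact ⟨(-x - 1) / 4, -1, Or.inr rfl, by omega⟩

lemma normCount_eq_card_triReps {c : ℕ} (hc : c = 2 ∨ c = 4) (i : ℕ) :
    normCount c (8 * i + 1 + c) = 4 * #(triReps c i) := by
  have hc1 : (1 : ℤ) ≤ c := by omega
  have key : #(triReps c i ×ˢ (({1, -1} : Finset ℤ) ×ˢ ({1, -1} : Finset ℤ))) =
      #(normReps c ((8 * i + 1 + c : ℕ) : ℤ)) := by
    refine card_bij (fun v _ => (v.2.1 * (4 * v.1.1 + 1), v.2.2 * (4 * v.1.2 + 1))) ?_ ?_ ?_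
    · rintro ⟨⟨a, b⟩, s, t⟩ h
      simp only [mem_product, mem_triReps hc1, mem_insert, mem_singleton, tri] at h
      rw [mem_normReps hc1]
      obtain ⟨h, hs, ht⟩ := h
      have hs' : s ^ 2 = 1 := by rcases hs with rfl | rfl <;> norm_num
      have ht' : t ^ 2 = 1 := by rcases ht with rfl | rfl <;> norm_num
      simp only [mul_pow, hs', ht']
      push_cast
      linear_combination 8 * h
    · rintro ⟨⟨a, b⟩, s, t⟩ h ⟨⟨a', b'⟩, s', t'⟩ h' heq
      simp only [mem_product, mem_insert, mem_singleton] at h h'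
      obtain ⟨-, hs, ht⟩ := h
      obtain ⟨-, hs', ht'⟩ := h'
      simp only [Prod.mk.injEq] at heq ⊢
      rcases hs with rfl | rfl <;> rcases ht with rfl | rfl <;> rcases hs' with rfl | rfl <;>
        rcases ht' with rfl | rfl <;> omega
    · rintro ⟨x, y⟩ h
      rw [mem_normReps hc1] at h
      simp only at h
      push_cast at h
      have hx : x % 2 = 1 := by
        rcases Int.emod_two_eq_zero_or_one x with h0 | h0
        · obtain ⟨k, rfl⟩ : (2 : ℤ) ∣ x := by omega
          exfalso
          rcases hc with rfl | rfl <;> push_cast at h <;> ring_nf at h <;> omega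
        · exact h0
      have hy : y % 2 = 1 := by
        rcases Int.emod_two_eq_zero_or_one y with h0 | h0
        · obtain ⟨l, rfl⟩ : (2 : ℤ) ∣ y := by omega
          have hx8' := Int.eight_dvd_sq_sub_one_of_odd (Int.odd_iff.mpr hx)
          exfalso
          rcases hc with rfl | rfl
          · push_cast at h
            have : x ^ 2 + 8 * l ^ 2 = 8 * i + 1 + 2 := by linarith
            omega
          · push_cast at h
            have : x ^ 2 + 16 * l ^ 2 = 8 * i + 1 + 4 := by linarith
            omega
        · exact h0
      obtain ⟨k, s, hs, rfl⟩ := exists_sign_mul_eq_of_odd hx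
      obtain ⟨l, t, ht, rfl⟩ := exists_sign_mul_eq_of_odd hy
      refine ⟨((k, l), s, t), ?_, rfl⟩
      simp only [mem_product, mem_triReps hc1, mem_insert, mem_singleton, tri]
      refine ⟨?_, hs, ht⟩
      have hs' : s ^ 2 = 1 := by rcases hs with rfl | rfl <;> norm_num
      have ht' : t ^ 2 = 1 := by rcases ht with rfl | rfl <;> norm_num
      rw [mul_pow, mul_pow, hs', ht'] at h
      linarith
  have hpair : #({1, -1} : Finset ℤ) = 2 := by decide
  rw [card_product, card_product, hpair] at key
  rw [normCount, ← key]
  push_cast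
  ring

lemma normCount_one_eq_two_mul {m : ℕ} (hm : m % 2 = 1) :
    normCount 1 m = 2 * normCount 4 m := by
  have hodd : #{v ∈ normReps 1 m | v.1 % 2 = 1} = #(normReps 4 m) := by
    symm
    refine card_bij (fun v _ => (v.1, 2 * v.2)) ?_ ?_ ?_
    · rintro ⟨x, y⟩ h
      rw [mem_normReps (by norm_num)] at h
      rw [mem_filter, mem_normReps le_rfl]
      simp only at h ⊢
      refine ⟨by linarith, ?_⟩
      rcases Int.emod_two_eq_zero_or_one x with h0 | h0
      · obtain ⟨k, rfl⟩ : (2 : ℤ) ∣ x := by omega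
        ring_nf at h
        omega
      · exact h0
    · rintro ⟨x, y⟩ _ ⟨x', y'⟩ _ h
      simpa using h
    · rintro ⟨x, y⟩ h
      rw [mem_filter, mem_normReps le_rfl] at h
      simp only at h
      obtain ⟨h, hx⟩ := h
      have hx8 := Int.sq_mod_four_eq_one_of_odd (Int.odd_iff.mpr hx)
      rcases Int.emod_two_eq_zero_or_one y with h0 | h0
      · obtain ⟨k, rfl⟩ : (2 : ℤ) ∣ y := by omega
        exact ⟨(x, k), by rw [mem_normReps (by norm_num)]; linarith, rfl⟩
      · have hy8 := Int.sq_mod_four_eq_one_of_odd (Int.odd_iff.mpr h0)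
        omega
  have heven : #{v ∈ normReps 1 m | ¬ v.1 % 2 = 1} = #{v ∈ normReps 1 m | v.1 % 2 = 1} := by
    have parity : ∀ x y : ℤ, x ^ 2 + 1 * y ^ 2 = m → (¬ x % 2 = 1 ↔ y % 2 = 1) := by
      intro x y h
      have h1 : Odd (x ^ 2 + 1 * y ^ 2) := by rw [h]; exact Int.odd_iff.mpr (by omega)
      rw [one_mul, Int.odd_add, Int.odd_pow' two_ne_zero, Int.even_pow' two_ne_zero,
        Int.odd_iff, Int.even_iff] at h1
      omega
    refine card_nbij' Prod.swap Prod.swap ?_ ?_ (fun _ _ => Prod.swap_swap _)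
      (fun _ _ => Prod.swap_swap _)
    · rintro ⟨x, y⟩ h
      simp only [coe_filter, Set.mem_ofPred_eq, mem_normReps le_rfl, Prod.swap] at h ⊢
      exact ⟨by linarith, (parity x y h.1).mp h.2⟩
    · rintro ⟨x, y⟩ h
      simp only [coe_filter, Set.mem_ofPred_eq, mem_normReps le_rfl, Prod.swap] at h ⊢
      have h' : y ^ 2 + 1 * x ^ 2 = (m : ℤ) := by linarith
      exact ⟨h', (parity y x h').mpr h.2⟩
  have := card_filter_add_card_filter_not (s := normReps 1 m) (fun v => v.1 % 2 = 1)
  rw [normCount, normCount, ← this, heven, hodd]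
  push_cast
  ring

lemma card_triReps_two (i : ℕ) :
    (#(triReps 2 i) : ℤ) = ∑ d ∈ (8 * i + 3).divisors, threeSubFive d := by
  have h1 := normCount_eq_card_triReps (c := 2) (Or.inl rfl) i
  have h2 := normCount_two_eq (8 * i + 3) (Nat.odd_iff.mpr (by omega))
  rw [sum_divisors_χ₈' (by omega)] at h2
  rw [show 8 * i + 1 + 2 = 8 * i + 3 by ring] at h1
  push_cast at h1
  linarith

lemma card_triReps_four (i : ℕ) :
    (#(triReps 4 i) : ℤ) = -∑ d ∈ (8 * i + 5).divisors, threeSubFive d := by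
  have h1 := normCount_eq_card_triReps (c := 4) (Or.inr rfl) i
  have h2 := normCount_one_eq (8 * i + 5) (Nat.odd_iff.mpr (by omega))
  have h3 := normCount_one_eq_two_mul (m := 8 * i + 5) (by omega)
  rw [sum_divisors_χ₄ (by omega)] at h2
  rw [show 8 * i + 1 + 4 = 8 * i + 5 by ring] at h1
  push_cast at h1
  linarith

lemma sum_antidiagonal_eq_productPairs (n : ℕ) :
    ∑ ij ∈ antidiagonal n, (∑ v ∈ factorPairs ((8 * ij.1 + 3 : ℕ) : ℤ) 1, v.1.sign) *
      (∑ w ∈ factorPairs ((8 * ij.2 + 5 : ℕ) : ℤ) 7, w.1.sign) =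
    ∑ q ∈ productPairs (8 * (n + 1 : ℕ)), (q.1 * q.2.2.1).sign := by
  simp_rw [sum_mul_sum, ← sum_product']
  rw [sum_sigma']
  refine sum_bij (fun p _ => (p.2.1.1, p.2.1.2, p.2.2.1, p.2.2.2)) ?_ ?_ ?_ ?_
  · rintro ⟨⟨i, j⟩, ⟨d, x⟩, ⟨e, y⟩⟩ h
    rw [mem_sigma, HasAntidiagonal.mem_antidiagonal, mem_product,
      mem_factorPairs (by simp only; omega), mem_factorPairs (by simp only; omega)] at h
    simp only at h
    obtain ⟨hij, ⟨h1, hd, hx⟩, h2, he, hy⟩ := h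
    refine mem_productPairs.mpr ⟨⟨hd, hx, he, hy⟩, ?_, ?_, ?_⟩
    · rw [h1]; omega
    · rw [h2]; omega
    · rw [h1, h2]; push_cast; omega
  · rintro ⟨⟨i, j⟩, ⟨d, x⟩, ⟨e, y⟩⟩ h ⟨⟨i', j'⟩, ⟨d', x'⟩, ⟨e', y'⟩⟩ h' heq
    rw [mem_sigma, HasAntidiagonal.mem_antidiagonal, mem_product,
      mem_factorPairs (by simp only; omega), mem_factorPairs (by simp only; omega)] at h h'
    simp only [Prod.mk.injEq] at h h' heq
    obtain ⟨rfl, rfl, rfl, rfl⟩ := heq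
    obtain rfl : i = i' := by omega
    obtain rfl : j = j' := by omega
    rfl
  · rintro ⟨d, x, e, y⟩ h
    obtain ⟨⟨hd, hx, he, hy⟩, h1, h2, h3⟩ := mem_productPairs.mp h
    have h4 : d * x % 8 = 3 := by rw [Int.mul_emod, hd, hx]; norm_num
    have h5 : e * y % 8 = 5 := by rw [Int.mul_emod, he, hy]; norm_num
    refine ⟨⟨(((d * x - 3) / 8).toNat, ((e * y - 5) / 8).toNat), ((d, x), (e, y))⟩, ?_, rfl⟩
    rw [mem_sigma, HasAntidiagonal.mem_antidiagonal, mem_product,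
      mem_factorPairs (by simp only; omega), mem_factorPairs (by simp only; omega)]
    simp only
    refine ⟨?_, ⟨?_, hd, hx⟩, ?_, he, hy⟩ <;> push_cast at h3 ⊢ <;> omega
  · rintro ⟨⟨i, j⟩, ⟨d, x⟩, ⟨e, y⟩⟩ _
    exact (Int.sign_mul d e).symm

/-- The change of variables behind `y² + 2 · tri j = tri k + tri l`. -/
def sqTriEquiv : ℤ × ℤ ≃ ℤ × ℤ where
  toFun v := if v.1 % 2 = 0 then (v.2 + v.1 / 2, v.2 - v.1 / 2)
    else (-v.2 - v.1 / 2 - 1, v.1 / 2 - v.2)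
  invFun w := if (w.1 + w.2) % 2 = 0 then (w.1 - w.2, (w.1 + w.2) / 2)
    else (w.2 - w.1, -((w.1 + w.2 + 1) / 2))
  left_inv := by
    rintro ⟨y, j⟩
    by_cases h : y % 2 = 0
    · simp only [h, if_true]
      rw [if_pos (by omega)]
      simp only [Prod.mk.injEq]
      omega
    · simp only [h, if_false]
      rw [if_neg (by omega)]
      simp only [Prod.mk.injEq]
      omega
  right_inv := by
    rintro ⟨k, l⟩
    by_cases h : (k + l) % 2 = 0
    · simp only [h, if_true]
      rw [if_pos (by omega)]
      simp only [Prod.mk.injEq]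
      omega
    · simp only [h, if_false]
      rw [if_neg (by omega)]
      simp only [Prod.mk.injEq]
      omega

lemma tri_sqTriEquiv (y j : ℤ) :
    tri (sqTriEquiv (y, j)).1 + tri (sqTriEquiv (y, j)).2 = y ^ 2 + 2 * tri j := by
  simp only [sqTriEquiv, Equiv.coe_fn_mk, tri]
  rcases Int.emod_two_eq_zero_or_one y with h | h
  · obtain ⟨i, rfl⟩ : (2 : ℤ) ∣ y := by omega
    rw [if_pos h, Int.mul_ediv_cancel_left _ two_ne_zero]
    ring
  · obtain ⟨i, rfl⟩ : ∃ i, y = 2 * i + 1 := ⟨y / 2, by omega⟩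
    rw [if_neg (by omega), show (2 * i + 1) / 2 = i by omega]
    ring

lemma triangle_eq_tri (z : ℕ) :
    ((z * (z + 1) / 2 : ℕ) : ℤ) = tri (Equiv.intEquivNat.symm z) := by
  obtain ⟨k, rfl⟩ := Equiv.intEquivNat.surjective z
  rw [Equiv.symm_apply_apply]
  rcases k with k | k
  · have h : Equiv.intEquivNat (Int.ofNat k) = 2 * k := rfl
    rw [h, show 2 * k * (2 * k + 1) = 2 * (k * (2 * k + 1)) by ring,
      Nat.mul_div_cancel_left _ two_pos, tri]
    push_cast
    simp only [Int.ofNat_eq_natCast]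
    ring
  · have h : Equiv.intEquivNat (Int.negSucc k) = 2 * k + 1 := rfl
    rw [h, show (2 * k + 1) * (2 * k + 1 + 1) = 2 * ((2 * k + 1) * (k + 1)) by ring,
      Nat.mul_div_cancel_left _ two_pos, tri, Int.negSucc_eq]
    push_cast
    ring

/-- The change of variables turning `y₁² + 2y₂² + 4·T(z₁) + 4·T(z₂)` into
`tri a + 2·tri b + tri c + 4·tri d`. -/
def quadEquiv : (Fin 2 → ℤ) × (Fin 2 → ℕ) ≃ (ℤ × ℤ) × (ℤ × ℤ) where
  toFun p :=
    let u := sqTriEquiv (p.1 1, Equiv.intEquivNat.symm (p.2 0))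
    let v := sqTriEquiv (p.1 0, u.1)
    ((v.1, u.2), (v.2, Equiv.intEquivNat.symm (p.2 1)))
  invFun w :=
    let v := sqTriEquiv.symm (w.1.1, w.2.1)
    let u := sqTriEquiv.symm (v.2, w.1.2)
    (![v.1, u.1], ![Equiv.intEquivNat u.2, Equiv.intEquivNat w.2.2])
  left_inv := by
    rintro ⟨y, z⟩
    simp only [Prod.mk.eta, Equiv.symm_apply_apply, Equiv.apply_symm_apply, Prod.mk.injEq]
    constructor <;> ext i <;> fin_cases i <;> rfl
  right_inv := by
    rintro ⟨⟨a, b⟩, c, d⟩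
    simp

lemma tri_quadEquiv (p : (Fin 2 → ℤ) × (Fin 2 → ℕ)) :
    tri (quadEquiv p).1.1 + 2 * tri (quadEquiv p).1.2 +
        (tri (quadEquiv p).2.1 + 4 * tri (quadEquiv p).2.2) =
      ∑ i, ((![1, 2] i : ℕ) : ℤ) * p.1 i ^ 2 +
        ∑ j, ((![4, 4] j : ℕ) : ℤ) * ((p.2 j * (p.2 j + 1) / 2 : ℕ) : ℤ) := by
  have h1 := tri_sqTriEquiv (p.1 1) (Equiv.intEquivNat.symm (p.2 0))
  have h2 := tri_sqTriEquiv (p.1 0)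
    (sqTriEquiv (p.1 1, Equiv.intEquivNat.symm (p.2 0))).1
  simp only [Fin.sum_univ_two, triangle_eq_tri, quadEquiv, Equiv.coe_fn_mk, Matrix.cons_val_zero,
    Matrix.cons_val_one, Matrix.cons_val_fin_one, Nat.cast_one, Nat.cast_ofNat]
  linarith

lemma NstRep_eq_sum (m : ℕ) :
    NstRep 2 2 ![1, 2] ![4, 4] m =
      ∑ ij ∈ antidiagonal m, #(triReps 2 ij.1) * #(triReps 4 ij.2) := by
  simp_rw [← card_product]
  rw [← card_sigma, NstRep, ← Set.ncard_coe_finset]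
  symm
  have hmem : ∀ i j : ℕ, ∀ w : (ℤ × ℤ) × (ℤ × ℤ),
      (⟨(i, j), w⟩ : Σ _ : ℕ × ℕ, (ℤ × ℤ) × (ℤ × ℤ)) ∈
        ((antidiagonal m).sigma fun ij => triReps 2 ij.1 ×ˢ triReps 4 ij.2) ↔
      i + j = m ∧ tri w.1.1 + 2 * tri w.1.2 = i ∧ tri w.2.1 + 4 * tri w.2.2 = j := by
    rintro i j ⟨⟨a, b⟩, c, d⟩
    rw [mem_sigma, HasAntidiagonal.mem_antidiagonal, mem_product, mem_triReps (by norm_num),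
      mem_triReps (by norm_num)]
  refine Set.ncard_congr (fun s _ => quadEquiv.symm s.2) ?_ ?_ ?_
  · rintro ⟨⟨i, j⟩, w⟩ h
    obtain ⟨p, rfl⟩ := quadEquiv.surjective w
    obtain ⟨hij, h1, h2⟩ := (hmem _ _ _).mp (mem_coe.mp h)
    simp only [Equiv.symm_apply_apply]
    change (m : ℤ) = _
    rw [← tri_quadEquiv, h1, h2, ← hij, Nat.cast_add]
  · rintro ⟨⟨i, j⟩, w⟩ ⟨⟨i', j'⟩, w'⟩ h h' heq
    obtain rfl : w = w' := quadEquiv.symm.injective heq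
    obtain ⟨-, h1, h2⟩ := (hmem _ _ _).mp (mem_coe.mp h)
    obtain ⟨-, h1', h2'⟩ := (hmem _ _ _).mp (mem_coe.mp h')
    obtain rfl : i = i' := by exact_mod_cast h1.symm.trans h1'
    obtain rfl : j = j' := by exact_mod_cast h2.symm.trans h2'
    rfl
  · rintro p h
    change (m : ℤ) = _ at h
    rw [← tri_quadEquiv] at h
    have ha := tri_nonneg (quadEquiv p).1.1
    have hb := tri_nonneg (quadEquiv p).1.2
    have hc := tri_nonneg (quadEquiv p).2.1
    have hd := tri_nonneg (quadEquiv p).2.2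
    refine ⟨⟨((tri (quadEquiv p).1.1 + 2 * tri (quadEquiv p).1.2).toNat,
      (tri (quadEquiv p).2.1 + 4 * tri (quadEquiv p).2.2).toNat), quadEquiv p⟩,
      mem_coe.mpr ((hmem _ _ _).mpr ?_), quadEquiv.symm_apply_apply p⟩
    omega

theorem Nst_12_44_formula (n : ℕ) (hn : 1 ≤ n) :
    (NstRep 2 2 ![1, 2] ![4, 4] (n - 1) : ℤ) =
      ∑ d ∈ n.divisors, chi8 ((n / d : ℕ) : ℤ) * (d : ℤ) := by
  obtain ⟨m, rfl⟩ : ∃ m, n = m + 1 := ⟨n - 1, by omega⟩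
  have h := sum_sign_productPairs (n := m + 1) (Nat.succ_ne_zero m)
  rw [← sum_antidiagonal_eq_productPairs] at h
  rw [Nat.add_sub_cancel, NstRep_eq_sum, ← neg_inj, ← h, Nat.cast_sum, ← sum_neg_distrib]
  refine sum_congr rfl fun ij _ => ?_
  rw [Nat.cast_mul, card_triReps_two, card_triReps_four,
    sum_sign_factorPairs (by omega) (Or.inl rfl) (by push_cast; omega),
    sum_sign_factorPairs (by omega) (Or.inr rfl) (by push_cast; omega)]
  ring
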